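/- Let M be a matroid on the finite ground set {1,…,n} with rank function rank : 2^{[n]} → ℕ, where rank(S) is the cardinality of a largest independent subset of S. Let 0 < q ≤ 1 be real, let λ₁,…,λₙ > 0 be positive reals, and let 0 ≤ k ≤ n. Then the polynomial f_{M,k,q}(x₁,…,xₙ) = Σ_{S ⊆ {1,…,n}, |S| = k} q^{−rank(S)}·(∏_{i∈S} λ_i)·∏_{i∈S} x_i is strongly log-concave at 𝟙. -/

import Mathlib

open MvPolynomial Matrix Finset
open scoped Classical

noncomputable section

abbrev MP (n : ℕ) := MvPolynomial (Fin n) ℝ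

/-- Iterated partial derivative along a list of indices. -/
def derivList {n : ℕ} (l : List (Fin n)) (q : MP n) : MP n :=
  l.foldr (fun i r => pderiv i r) q

/-- Gradient at the all-ones point. -/
def gradOne {n : ℕ} (q : MP n) : Fin n → ℝ := fun i => eval (fun _ => (1:ℝ)) (pderiv i q)

/-- Hessian at the all-ones point. -/
def hessOne {n : ℕ} (q : MP n) : Matrix (Fin n) (Fin n) ℝ :=
  Matrix.of fun i j => eval (fun _ => (1:ℝ)) (pderiv i (pderiv j q))

/-- `q` is log-concave at the all-ones point: `q(𝟙)·∇²q(𝟙) − ∇q(𝟙)∇q(𝟙)ᵀ` is NSD,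
equivalently its negation is PSD. -/
def LogConcaveAtOne {n : ℕ} (q : MP n) : Prop :=
  (vecMulVec (gradOne q) (gradOne q) - eval (fun _ => (1:ℝ)) q • hessOne q).PosSemidef

/-- `q` is strongly log-concave at the all-ones point. -/
def StronglyLogConcaveAtOne {n : ℕ} (q : MP n) : Prop :=
  ∀ l : List (Fin n), LogConcaveAtOne (derivList l q)

/-- The rank of `S` in the matroid `M`: the cardinality of a largest independent
subset of `S`. -/
def matRank (n : ℕ) (M : Matroid (Fin n)) (S : Finset (Fin n)) : ℕ :=
  (Finset.univ.filter
    (fun I : Finset (Fin n) => M.Indep (↑I : Set (Fin n)) ∧ I ⊆ S)).sup Finset.card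

lemma spec_aux {ι : Type} [Fintype ι] (H : ι → ι → ℝ) (d y : ι → ℝ) (m : ℝ)
    (hs : ∀ i j, H i j = H j i) (hn : ∀ i j, 0 ≤ H i j)
    (hd : ∀ i, ∑ j, H i j = d i)
    (hp : ∀ i j, i ≠ j → 0 < d i → 0 < d j → 0 < H i j)
    (hyp : ∑ i, ∑ j, H i j * y i * y j ≤ ∑ i, (∑ j, H i j * y j) ^ 2 / d i)
    (hD : 0 < ∑ i, d i) (hm : 0 < m)
    (he : ∀ i, m * d i * y i = (∑ j, H i j * y j) - d i * (∑ j, d j * y j) / ∑ j, d j) :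
    ∑ i, d i * y i ^ 2 ≤ 0 := by
  have hd0 : ∀ i, 0 ≤ d i := fun i => hd i ▸ Finset.sum_nonneg (fun j _ => hn i j)
  have hsum : ∑ i, ∑ j, H i j * y j = ∑ j, d j * y j := by
    rw [Finset.sum_comm]
    refine Finset.sum_congr rfl fun j _ => ?_
    rw [← Finset.sum_mul, ← hd j]
    congr 1
    exact Finset.sum_congr rfl fun i _ => hs i j
  have ha : ∑ j, d j * y j = 0 := by
    have h1 := Finset.sum_congr rfl (fun i (_ : i ∈ Finset.univ) => he i)
    rw [Finset.sum_sub_distrib, hsum, ← Finset.sum_div, ← Finset.sum_mul,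
      mul_div_cancel_left₀ _ hD.ne', sub_self] at h1
    have : m * ∑ j, d j * y j = 0 := by
      rw [← h1, Finset.mul_sum]; exact Finset.sum_congr rfl fun i _ => by ring
    exact (mul_eq_zero.mp this).resolve_left hm.ne'
  have he' : ∀ i, ∑ j, H i j * y j = m * d i * y i := by
    intro i; rw [he i, ha]; simp
  have hq : ∑ i, ∑ j, H i j * y i * y j = m * ∑ i, d i * y i ^ 2 := by
    rw [Finset.mul_sum]
    refine Finset.sum_congr rfl fun i _ => ?_
    have : ∑ j, H i j * y i * y j = y i * ∑ j, H i j * y j := by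
      rw [Finset.mul_sum]; exact Finset.sum_congr rfl fun j _ => by ring
    rw [this, he']; ring
  have hq2 : ∑ i, (∑ j, H i j * y j) ^ 2 / d i = m ^ 2 * ∑ i, d i * y i ^ 2 := by
    rw [Finset.mul_sum]
    refine Finset.sum_congr rfl fun i _ => ?_
    rw [he']
    by_cases h : d i = 0
    · simp [h]
    · field_simp
  rw [hq, hq2] at hyp
  set P := ∑ i, d i * y i ^ 2 with hP
  by_contra hcon
  push Not at hcon
  have hm1 : 1 ≤ m := by
    by_contra h
    push Not at h
    nlinarith [mul_pos hm hcon]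
  have hsq : ∑ i, ∑ j, H i j * (y i - y j) ^ 2 = 2 * P - 2 * (m * P) := by
    have e1 : ∑ i, ∑ j, H i j * y i ^ 2 = P := by
      refine Finset.sum_congr rfl fun i _ => ?_
      rw [← Finset.sum_mul, hd]
    have e2 : ∑ i, ∑ j, H i j * y j ^ 2 = P := by
      rw [Finset.sum_comm, ← e1]
      exact Finset.sum_congr rfl fun i _ => Finset.sum_congr rfl fun j _ => by rw [hs]
    rw [← hq]
    have : ∀ i j, H i j * (y i - y j) ^ 2
        = H i j * y i ^ 2 + H i j * y j ^ 2 - 2 * (H i j * y i * y j) := fun i j => by ring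
    simp only [this, Finset.sum_sub_distrib, Finset.sum_add_distrib, ← Finset.mul_sum, e1, e2]
    ring
  have hz : ∑ i, ∑ j, H i j * (y i - y j) ^ 2 = 0 := by
    apply le_antisymm
    · rw [hsq]; nlinarith
    · exact Finset.sum_nonneg fun i _ => Finset.sum_nonneg fun j _ => mul_nonneg (hn i j) (sq_nonneg _)
  have hz' : ∀ i j, H i j * (y i - y j) ^ 2 = 0 := by
    intro i j
    have h1 := (Finset.sum_eq_zero_iff_of_nonneg (fun i _ => Finset.sum_nonneg fun j _ =>
      mul_nonneg (hn i j) (sq_nonneg (y i - y j)))).mp hz i (Finset.mem_univ _)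
    exact (Finset.sum_eq_zero_iff_of_nonneg (fun j _ =>
      mul_nonneg (hn i j) (sq_nonneg (y i - y j)))).mp h1 j (Finset.mem_univ _)
  have heq : ∀ i j, 0 < d i → 0 < d j → y i = y j := by
    intro i j hi hj
    by_cases hij : i = j
    · rw [hij]
    · have := (mul_eq_zero.mp (hz' i j)).resolve_left (hp i j hij hi hj).ne'
      exact sub_eq_zero.mp (pow_eq_zero_iff (two_ne_zero) |>.mp this)
  have hy0 : ∀ i, 0 < d i → y i = 0 := by
    intro i hi
    have : ∑ j, d j * y j = (∑ j, d j) * y i := by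
      rw [Finset.sum_mul]
      refine Finset.sum_congr rfl fun j _ => ?_
      rcases (hd0 j).eq_or_lt with h | h
      · simp [← h]
      · rw [heq i j hi h]
    rw [ha] at this
    exact (mul_eq_zero.mp this.symm).resolve_left hD.ne'
  have : P = 0 := by
    rw [hP]
    refine Finset.sum_eq_zero fun i _ => ?_
    rcases (hd0 i).eq_or_lt with h | h
    · simp [← h]
    · simp [hy0 i h]
  linarith

lemma trickle {ι : Type} [Fintype ι] (H : ι → ι → ℝ) (d : ι → ℝ)
    (hs : ∀ i j, H i j = H j i) (hn : ∀ i j, 0 ≤ H i j)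
    (hd : ∀ i, ∑ j, H i j = d i)
    (hp : ∀ i j, i ≠ j → 0 < d i → 0 < d j → 0 < H i j)
    (hyp : ∀ y : ι → ℝ, ∑ i, ∑ j, H i j * y i * y j ≤ ∑ i, (∑ j, H i j * y j) ^ 2 / d i)
    (hD : 0 < ∑ i, d i) (x : ι → ℝ) :
    (∑ i, ∑ j, H i j * x i * x j) * ∑ i, d i ≤ (∑ i, d i * x i) ^ 2 := by
  have hd0 : ∀ i, 0 ≤ d i := fun i => hd i ▸ Finset.sum_nonneg (fun j _ => hn i j)
  have hH0 : ∀ i j, d i = 0 → H i j = 0 := by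
    intro i j h
    rw [← hd i] at h
    exact (Finset.sum_eq_zero_iff_of_nonneg (fun j _ => hn i j)).mp h j (Finset.mem_univ _)
  set s : ι → ℝ := fun i => Real.sqrt (d i) with hsdef
  have hss : ∀ i, s i * s i = d i := fun i => Real.mul_self_sqrt (hd0 i)
  have hs0 : ∀ i, s i = 0 → d i = 0 := fun i h => by rw [← hss, h, zero_mul]
  set D := ∑ i, d i with hDdef
  let N : Matrix ι ι ℝ := Matrix.of fun i j => s i * s j / D - H i j / (s i * s j)
  have hN : N.IsHermitian := by
    ext i j
    simp [N, hs i j, mul_comm (s i) (s j)]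
  have key : N.PosSemidef := by
    rw [hN.posSemidef_iff_eigenvalues_nonneg]
    intro k
    by_contra hneg
    simp only [Pi.zero_apply, not_le] at hneg
    set v : ι → ℝ := fun i => hN.eigenvectorBasis k i with hv
    have hev : ∀ i, ∑ j, N i j * v j = hN.eigenvalues k * v i := by
      intro i
      have := congrFun (hN.mulVec_eigenvectorBasis k) i
      simpa [Matrix.mulVec, dotProduct] using this
    have hvn : ∑ i, v i ^ 2 = 1 := by
      have h1 : ‖hN.eigenvectorBasis k‖ = 1 := hN.eigenvectorBasis.orthonormal.1 k
      have h2 := EuclideanSpace.real_norm_sq_eq (hN.eigenvectorBasis k)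
      rw [h1] at h2
      simpa using h2.symm
    have hv0 : ∀ i, d i = 0 → v i = 0 := by
      intro i hi
      have h1 := hev i
      have hsi : s i = 0 := by simp [hsdef, hi]
      simp [N, hsi] at h1
      rcases h1 with h | h
      · exact absurd h hneg.ne
      · exact h
    set y : ι → ℝ := fun i => v i / s i with hy
    have hvy : ∀ i, v i = s i * y i := by
      intro i
      by_cases h : s i = 0
      · rw [h, zero_mul, hv0 i (hs0 i h)]
      · simp only [hy]; field_simp
    have hfin := spec_aux H d y (-hN.eigenvalues k) hs hn hd hp (hyp y) hD (by linarith) (by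
      intro i
      by_cases h : s i = 0
      · have h0 := hs0 i h
        simp [h0, hH0 i _ h0]
      have h1 := hev i
      have h2 : s i * ∑ j, N i j * v j = d i * (∑ j, d j * y j) / D - ∑ j, H i j * y j := by
        rw [Finset.mul_sum, Finset.mul_sum, Finset.sum_div, ← Finset.sum_sub_distrib]
        refine Finset.sum_congr rfl fun j _ => ?_
        rw [hvy j, ← hss i, ← hss j]
        simp only [N, Matrix.of_apply]
        by_cases hj : s j = 0
        · have h0 := hH0 j i (hs0 j hj)
          rw [hs] at h0
          simp [hj, h0]
        · field_simp
      rw [h1, hvy i] at h2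
      rw [← hss i] at h2 ⊢
      linarith)
    have : ∑ i, d i * y i ^ 2 = 1 := by
      rw [← hvn]
      refine Finset.sum_congr rfl fun i _ => ?_
      rw [hvy, ← hss]; ring
    linarith
  have h := key.dotProduct_mulVec_nonneg (fun i => s i * x i)
  have e : star (fun i => s i * x i) ⬝ᵥ (N *ᵥ (fun i => s i * x i))
      = (∑ i, d i * x i) ^ 2 / D - ∑ i, ∑ j, H i j * x i * x j := by
    simp only [dotProduct, Matrix.mulVec, star_trivial]
    rw [sq, Finset.sum_mul_sum, Finset.sum_div, ← Finset.sum_sub_distrib]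
    refine Finset.sum_congr rfl fun i _ => ?_
    rw [Finset.mul_sum, Finset.sum_div, ← Finset.sum_sub_distrib]
    refine Finset.sum_congr rfl fun j _ => ?_
    rw [← hss i, ← hss j]
    simp only [N, Matrix.of_apply]
    by_cases hi : s i = 0
    · simp [hi, hH0 i j (hs0 i hi)]
    by_cases hj : s j = 0
    · have h0 := hH0 j i (hs0 j hj)
      rw [hs] at h0
      simp [hj, h0]
    · field_simp
  rw [e, sub_nonneg, le_div_iff₀ hD] at h
  exact h

lemma matRank_eq {n : ℕ} (M : Matroid (Fin n)) (S : Finset (Fin n)) :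
    ((matRank n M S : ℕ) : ℕ∞) = M.eRk (S : Set (Fin n)) := by
  apply le_antisymm
  · have hne : (Finset.univ.filter
      (fun I : Finset (Fin n) => M.Indep (↑I : Set (Fin n)) ∧ I ⊆ S)).Nonempty := ⟨∅, by simp⟩
    obtain ⟨I, hI, h⟩ := Finset.exists_mem_eq_sup _ hne Finset.card
    rw [matRank, h]
    simp only [Finset.mem_filter, Finset.mem_univ, true_and] at hI
    have := hI.1.encard_le_eRk_of_subset (X := (S : Set (Fin n))) (by exact_mod_cast hI.2)
    rwa [Set.encard_coe_eq_coe_finsetCard] at this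
  · rw [Matroid.eRk_le_iff]
    intro I hIS hI
    rw [← Set.coe_toFinset I, Set.encard_coe_eq_coe_finsetCard]
    norm_cast
    apply Finset.le_sup (f := Finset.card)
    simp only [Finset.mem_filter, Finset.mem_univ, true_and, Set.coe_toFinset]
    exact ⟨hI, by intro a ha; simpa using hIS (by simpa using ha)⟩

lemma rank_cross {n : ℕ} (M : Matroid (Fin n)) (hE : M.E = Set.univ) (T : Finset (Fin n))
    (i j : Fin n) :
    matRank n M (insert i (insert j T)) + matRank n M T +
      (if M.closure (insert i (T : Set (Fin n))) = M.closure (insert j (T : Set (Fin n))) ∧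
        i ∉ M.closure (T : Set (Fin n)) then 1 else 0)
    = matRank n M (insert i T) + matRank n M (insert j T) := by
  have hin : ∀ (X : Finset (Fin n)) e, e ∈ M.closure (X : Set (Fin n)) →
      matRank n M (insert e X) = matRank n M X := by
    intro X e he
    have : ((matRank n M (insert e X) : ℕ) : ℕ∞) = (matRank n M X : ℕ) := by
      rw [matRank_eq, matRank_eq, Finset.coe_insert, ← M.eRk_closure_eq,
        Matroid.closure_insert_eq_of_mem_closure he, M.eRk_closure_eq]
    exact_mod_cast this
  have hout : ∀ (X : Finset (Fin n)) e, e ∉ M.closure (X : Set (Fin n)) →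
      matRank n M (insert e X) = matRank n M X + 1 := by
    intro X e he
    have : ((matRank n M (insert e X) : ℕ) : ℕ∞) = (matRank n M X : ℕ) + 1 := by
      rw [matRank_eq, matRank_eq, Finset.coe_insert]
      exact Matroid.eRk_insert_eq_add_one ⟨by simp [hE], he⟩
    exact_mod_cast this
  have hsub : ∀ X : Set (Fin n), X ⊆ M.closure X := fun X =>
    M.subset_closure X (by simp [hE])
  by_cases hi : i ∈ M.closure (T : Set (Fin n))
  · have h2 : i ∈ M.closure ((insert j T : Finset (Fin n)) : Set (Fin n)) :=
      M.closure_subset_closure (by simp) hi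
    rw [hin _ _ hi, hin _ _ h2, if_neg (by tauto)]
    omega
  · rw [hout _ _ hi]
    by_cases hij : i ∈ M.closure (insert j (T : Set (Fin n)))
    · have hji := (Matroid.closure_exchange ⟨hij, hi⟩).1
      have hc : M.closure (insert i (T : Set (Fin n))) = M.closure (insert j (T : Set (Fin n))) := by
        apply Set.Subset.antisymm
        · apply M.closure_subset_closure_of_subset_closure
          exact Set.insert_subset hij ((Set.subset_insert _ _).trans (hsub _))
        · apply M.closure_subset_closure_of_subset_closure
          exact Set.insert_subset hji ((Set.subset_insert _ _).trans (hsub _))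
      rw [hin (insert j T) i (by simpa using hij), if_pos ⟨hc, hi⟩]
      omega
    · rw [hout (insert j T) i (by simpa using hij), if_neg]
      · omega
      · rintro ⟨h, -⟩
        exact hij (h ▸ hsub _ (Set.mem_insert _ _))

/-- base-case quadratic form bound -/
lemma base_form {n : ℕ} (M : Matroid (Fin n)) (hE : M.E = Set.univ) (T : Finset (Fin n)) (q : ℝ) (hq0 : 0 < q)
    (hq1 : q ≤ 1) (y : Fin n → ℝ) :
    ∑ i, ∑ j, (if i = j then 0 else
      q ^ (if M.closure (insert i (T : Set (Fin n))) = M.closure (insert j (T : Set (Fin n))) ∧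
        i ∉ M.closure (T : Set (Fin n)) then 1 else 0)) * y i * y j ≤ (∑ i, y i) ^ 2 := by
  set c : Fin n → Set (Fin n) := fun i => M.closure (insert i (T : Set (Fin n))) with hc
  set z : Fin n → ℝ := fun i => if i ∈ M.closure (T : Set (Fin n)) then 0 else y i with hz
  have hcz : ∀ i j, c i = c j → i ∉ M.closure (T : Set (Fin n)) →
      j ∉ M.closure (T : Set (Fin n)) := by
    intro i j hij hi hj
    apply hi
    have : c j = M.closure T := Matroid.closure_insert_eq_of_mem_closure hj
    rw [← this, ← hij]
    exact M.mem_closure_of_mem' (Set.mem_insert _ _) (by simp [hE])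
  have hpt : ∀ i j, (if i = j then 0 else
      q ^ (if c i = c j ∧ i ∉ M.closure (T : Set (Fin n)) then 1 else 0)) * y i * y j
      = y i * y j - (1 - q) * (if c i = c j then z i * z j else 0)
        - (if i = j then y i ^ 2 - (1 - q) * z i ^ 2 else 0) := by
    intro i j
    by_cases hij : i = j
    · subst hij; simp; ring
    · by_cases hcc : c i = c j
      · by_cases hi : i ∈ M.closure (T : Set (Fin n))
        · simp [hij, hcc, hi, hz]
        · have := hcz i j hcc hi
          simp [hij, hcc, hi, hz, this]; ring
      · simp [hij, hcc]
  have hcls : ∑ i, ∑ j, (if c i = c j then z i * z j else 0)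
      = ∑ K : Set (Fin n), (∑ i, if c i = K then z i else 0) ^ 2 := by
    have : ∀ i j, (if c i = c j then z i * z j else 0)
        = ∑ K : Set (Fin n), (if c i = K then z i else 0) * (if c j = K then z j else 0) := by
      intro i j
      rw [Finset.sum_eq_single (c i)]
      · by_cases h : c i = c j
        · simp [h]
        · simp [h, Ne.symm h]
      · intro K _ hK; simp [Ne.symm hK]
      · simp
    simp only [this]
    simp only [sq, Finset.sum_mul_sum]
    rw [Finset.sum_comm (s := (Finset.univ : Finset (Set (Fin n))))]
    exact Finset.sum_congr rfl fun i _ => Finset.sum_comm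
  refine (Finset.sum_congr rfl fun i _ => Finset.sum_congr rfl fun j _ => hpt i j).trans_le ?_
  simp only [Finset.sum_sub_distrib, ← Finset.mul_sum]
  simp only [hcls]
  have h1 : 0 ≤ ∑ K : Set (Fin n), (∑ i, if c i = K then z i else 0) ^ 2 :=
    Finset.sum_nonneg fun _ _ => sq_nonneg _
  have h3 : 0 ≤ ∑ i, ∑ j, (if i = j then y i ^ 2 - (1 - q) * z i ^ 2 else 0) := by
    refine Finset.sum_nonneg fun i _ => ?_
    simp only [Finset.sum_ite_eq, Finset.mem_univ, if_true]
    simp only [hz]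
    split_ifs
    · nlinarith [sq_nonneg (y i)]
    · nlinarith [sq_nonneg (y i)]
  have h2' : ∑ i, y i * ∑ j, y j = (∑ i, y i) ^ 2 := by rw [← Finset.sum_mul, sq]
  rw [h2']
  have h4 := mul_nonneg (sub_nonneg.mpr hq1) h1
  linarith

/-- up-sum of the weight -/
def FF {n : ℕ} (k : ℕ) (w : Finset (Fin n) → ℝ) (T : Finset (Fin n)) : ℝ :=
  ∑ S ∈ Finset.univ.filter (fun S : Finset (Fin n) => S.card = k), if T ⊆ S then w S else 0

def GG {n : ℕ} (k : ℕ) (w : Finset (Fin n) → ℝ) (T : Finset (Fin n)) (i : Fin n) : ℝ :=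
  if i ∈ T then 0 else FF k w (insert i T)

def HH {n : ℕ} (k : ℕ) (w : Finset (Fin n) → ℝ) (T : Finset (Fin n)) (i j : Fin n) : ℝ :=
  if j ∈ T then 0 else GG k w (insert j T) i

lemma FF_zero {n k : ℕ} (w : Finset (Fin n) → ℝ) (T : Finset (Fin n)) (h : k < T.card) :
    FF k w T = 0 := by
  refine Finset.sum_eq_zero fun S hS => if_neg fun hTS => ?_
  have := Finset.card_le_card hTS
  simp at hS
  omega

lemma FF_nonneg {n k : ℕ} (w : Finset (Fin n) → ℝ) (hw : ∀ S, 0 < w S) (T : Finset (Fin n)) :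
    0 ≤ FF k w T :=
  Finset.sum_nonneg fun S _ => by split_ifs; exacts [(hw S).le, le_rfl]

lemma FF_pos {n k : ℕ} (hk : k ≤ n) (w : Finset (Fin n) → ℝ) (hw : ∀ S, 0 < w S)
    (T : Finset (Fin n)) (h : T.card ≤ k) : 0 < FF k w T := by
  obtain ⟨S, hTS, -, hS⟩ := Finset.exists_subsuperset_card_eq (Finset.subset_univ T) h (by simpa)
  refine Finset.sum_pos' (fun S _ => by split_ifs; exacts [(hw S).le, le_rfl]) ⟨S, by simp [hS], ?_⟩
  simp [hTS, hw]

lemma FF_top {n k : ℕ} (w : Finset (Fin n) → ℝ) (T : Finset (Fin n)) (h : T.card = k) :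
    FF k w T = w T := by
  rw [FF, Finset.sum_eq_single T]
  · simp
  · intro S hS hne
    rw [if_neg]
    intro hTS
    apply hne
    simp at hS
    exact (Finset.eq_of_subset_of_card_le hTS (by omega)).symm
  · intro hT; simp [h] at hT

lemma sum_GG {n k : ℕ} (w : Finset (Fin n) → ℝ) (T : Finset (Fin n)) :
    ∑ i, GG k w T i = ((k : ℝ) - T.card) * FF k w T := by
  have : ∀ i, GG k w T i = ∑ S ∈ Finset.univ.filter (fun S : Finset (Fin n) => S.card = k),
      if T ⊆ S then (if i ∈ S \ T then w S else 0) else 0 := by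
    intro i
    unfold GG FF
    split_ifs with h
    · symm; refine Finset.sum_eq_zero fun S _ => by simp [h]
    · refine Finset.sum_congr rfl fun S _ => ?_
      by_cases h1 : T ⊆ S <;> by_cases h2 : i ∈ S <;> simp [Finset.insert_subset_iff, h1, h2, h]
  simp only [this]
  rw [Finset.sum_comm, FF, Finset.mul_sum]
  refine Finset.sum_congr rfl fun S hS => ?_
  simp only [Finset.mem_filter, Finset.mem_univ, true_and] at hS
  by_cases h1 : T ⊆ S
  · simp only [h1, if_true]
    rw [Finset.sum_ite_mem, Finset.univ_inter, Finset.sum_const, nsmul_eq_mul,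
      Finset.card_sdiff_of_subset h1, Nat.cast_sub (Finset.card_le_card h1), hS]
  · simp [h1]

lemma HH_symm {n k : ℕ} (w : Finset (Fin n) → ℝ) (T : Finset (Fin n)) (i j : Fin n) :
    HH k w T i j = HH k w T j i := by
  unfold HH GG
  by_cases hij : i = j
  · rw [hij]
  · by_cases hi : i ∈ T <;> by_cases hj : j ∈ T <;>
      simp [hi, hj, hij, Ne.symm hij, Finset.insert_comm]

lemma GG_nonneg {n k : ℕ} (w : Finset (Fin n) → ℝ) (hw : ∀ S, 0 < w S) (T : Finset (Fin n)) (i) :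
    0 ≤ GG k w T i := by
  unfold GG; split_ifs; exacts [le_rfl, FF_nonneg w hw _]

lemma HH_nonneg {n k : ℕ} (w : Finset (Fin n) → ℝ) (hw : ∀ S, 0 < w S) (T : Finset (Fin n)) (i j) :
    0 ≤ HH k w T i j := by
  unfold HH; split_ifs; exacts [le_rfl, GG_nonneg w hw _ _]

lemma sum_HH {n k : ℕ} (w : Finset (Fin n) → ℝ) (T : Finset (Fin n)) (i : Fin n) :
    ∑ j, HH k w T i j = ((k : ℝ) - T.card - 1) * GG k w T i := by
  simp only [HH_symm w T i]
  unfold HH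
  by_cases hi : i ∈ T
  · simp [hi, GG]
  · simp only [hi, if_false]
    rw [sum_GG, Finset.card_insert_of_notMem hi]
    simp only [GG, hi, if_false]
    push_cast; ring

lemma sum_HH_insert {n k : ℕ} (w : Finset (Fin n) → ℝ) (T : Finset (Fin n)) (a b : Fin n) :
    ∑ i, (if i ∈ T then 0 else HH k w (insert i T) a b)
      = ((k : ℝ) - T.card - 2) * HH k w T a b := by
  by_cases h : a ∉ T ∧ b ∉ T ∧ a ≠ b
  · obtain ⟨ha, hb, hab⟩ := h
    have e : HH k w T a b = FF k w (insert a (insert b T)) := by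
      simp [HH, GG, ha, hb, hab]
    have e2 : ∀ i, (if i ∈ T then 0 else HH k w (insert i T) a b)
        = GG k w (insert a (insert b T)) i := by
      intro i
      unfold HH GG
      by_cases hi : i ∈ T
      · simp [hi]
      · by_cases hia : i = a
        · simp [hia]
        · by_cases hib : i = b
          · simp [hib]
          · simp only [Finset.mem_insert, hi, ha, hb, hab, hia, hib, Ne.symm hia, Ne.symm hib,
              if_false, or_self]
            congr 1
            ext x; simp; tauto
    simp only [e2]
    rw [sum_GG, e, Finset.card_insert_of_notMem (by simp [ha, hab]),
      Finset.card_insert_of_notMem hb]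
    push_cast; ring
  · have e : ∀ T', T ⊆ T' → HH k w T' a b = 0 := by
      intro T' hT
      unfold HH GG
      by_cases hb : b ∈ T'
      · simp [hb]
      · rw [if_neg hb, if_pos]
        have hb' : b ∉ T := fun h => hb (hT h)
        by_cases ha : a ∈ T
        · simp [hT ha]
        · have : a = b := by tauto
          simp [this]
    rw [e T subset_rfl, mul_zero]
    refine Finset.sum_eq_zero fun i _ => ?_
    rw [e _ (Finset.subset_insert _ _)]; simp

/-- Lorentzian inequality from the base case -/
lemma lorentz {n k : ℕ} (hk : k ≤ n) (w : Finset (Fin n) → ℝ) (hw : ∀ S, 0 < w S)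
    (hbase : ∀ T : Finset (Fin n), T.card + 2 = k → ∀ x : Fin n → ℝ,
      (∑ i, ∑ j, HH k w T i j * x i * x j) * ∑ i, GG k w T i ≤ (∑ i, GG k w T i * x i) ^ 2)
    (m : ℕ) : ∀ T : Finset (Fin n), T.card + 2 + m = k → ∀ x : Fin n → ℝ,
      (∑ i, ∑ j, HH k w T i j * x i * x j) * ((m + 1) * ∑ i, GG k w T i) ≤
        ((m + 1) * ∑ i, GG k w T i * x i) ^ 2 := by
  induction m with
  | zero => intro T hT x; simpa using hbase T hT x
  | succ m ih =>
    intro T hT x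
    have hkT : (k : ℝ) = T.card + 3 + m := by rw [← hT]; push_cast; ring
    have hcr : ∀ i, ∑ j, HH k w T i j = (m + 2) * GG k w T i := by
      intro i; rw [sum_HH, hkT]; ring
    have hm0 : (0 : ℝ) < m + 1 := by positivity
    have hGp : ∀ i, i ∉ T → 0 < GG k w T i := by
      intro i hi
      rw [GG, if_neg hi]
      apply FF_pos hk w hw
      rw [Finset.card_insert_of_notMem hi]; omega
    have := trickle (HH k w T) (fun i => (m + 2) * GG k w T i) (HH_symm w T) (HH_nonneg w hw T)
      hcr ?_ ?_ ?_ x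
    · push_cast
      simp only [mul_assoc, ← Finset.mul_sum] at this ⊢
      convert this using 3 <;> ring
    · intro i j hij hi hj
      have hiT : i ∉ T := fun h => by simp [GG, h] at hi
      have hjT : j ∉ T := fun h => by simp [GG, h] at hj
      rw [HH, if_neg hjT, GG, if_neg (by simp [hij, hiT])]
      apply FF_pos hk w hw
      rw [Finset.card_insert_of_notMem (by simp [hij, hiT]), Finset.card_insert_of_notMem hjT]
      omega
    · intro y
      have hc : (m + 1) * ∑ a, ∑ b, HH k w T a b * y a * y b
          = ∑ i, (if i ∈ T then 0 else ∑ a, ∑ b, HH k w (insert i T) a b * y a * y b) := by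
        have : ∀ i, (if i ∈ T then 0 else ∑ a, ∑ b, HH k w (insert i T) a b * y a * y b)
            = ∑ a, ∑ b, (if i ∈ T then 0 else HH k w (insert i T) a b) * y a * y b := by
          intro i; split_ifs <;> simp
        simp only [this]
        symm
        rw [Finset.sum_comm, Finset.mul_sum]
        refine Finset.sum_congr rfl fun a _ => ?_
        rw [Finset.sum_comm, Finset.mul_sum]
        refine Finset.sum_congr rfl fun b _ => ?_
        rw [← Finset.sum_mul, ← Finset.sum_mul, sum_HH_insert, hkT]
        ring
      have hle : (m + 1) * ∑ a, ∑ b, HH k w T a b * y a * y b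
          ≤ (m + 1) * ∑ i, (∑ j, HH k w T i j * y j) ^ 2 / ((m + 2) * GG k w T i) := by
        rw [hc, Finset.mul_sum]
        refine Finset.sum_le_sum fun i _ => ?_
        split_ifs with hi
        · have := GG_nonneg (k := k) w hw T i
          positivity
        · have h := ih (insert i T) (by rw [Finset.card_insert_of_notMem hi]; omega) y
          have hrow : ∀ j, HH k w T i j = GG k w (insert i T) j := by
            intro j; rw [HH_symm, HH, if_neg hi]
          simp only [← hrow] at h
          rw [hcr] at h
          have hg := hGp i hi
          rw [← mul_div_assoc, le_div_iff₀ (by positivity)]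
          have h2 : (m + 1 : ℝ) * ((∑ a, ∑ b, HH k w (insert i T) a b * y a * y b)
              * ((m + 2) * GG k w T i)) ≤ (m + 1) * ((m + 1) * (∑ j, HH k w T i j * y j) ^ 2) := by
            nlinarith
          exact le_of_mul_le_mul_left h2 hm0
      exact le_of_mul_le_mul_left hle hm0
    · rw [← Finset.mul_sum, sum_GG]
      have := FF_pos hk w hw T (by omega)
      have : (0:ℝ) < k - T.card := by rw [hkT]; ring_nf; positivity
      positivity

lemma rev_cs {ι : Type} [Fintype ι] (H : ι → ι → ℝ) (v g x : ι → ℝ)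
    (hs : ∀ i j, H i j = H j i) (hg : ∀ i, ∑ j, H i j = g i) (hpos : 0 < ∑ i, g i)
    (h : ∀ x : ι → ℝ, ∑ i, ∑ j, H i j * x i * x j ≤ (∑ i, v i * x i) ^ 2) :
    (∑ i, ∑ j, H i j * x i * x j) * ∑ i, g i ≤ (∑ i, g i * x i) ^ 2 := by
  have hv : 0 < (∑ i, v i) ^ 2 := by
    have := h (fun _ => 1)
    simp [hg] at this
    linarith
  have hv0 : ∑ i, v i ≠ 0 := fun h => by simp [h] at hv
  set s := (∑ i, v i * x i) / ∑ i, v i with hsd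
  have h1 := h (fun i => x i - s)
  have e1 : ∑ i, v i * (x i - s) = 0 := by
    simp only [mul_sub, Finset.sum_sub_distrib, ← Finset.sum_mul]
    rw [hsd]; field_simp; ring
  have e2 : ∑ i, ∑ j, H i j * (x i - s) * (x j - s)
      = ∑ i, ∑ j, H i j * x i * x j - 2 * s * ∑ i, g i * x i + s ^ 2 * ∑ i, g i := by
    have a1 : ∑ i, ∑ j, H i j * x i = ∑ i, g i * x i := by
      refine Finset.sum_congr rfl fun i _ => by rw [← Finset.sum_mul, hg]
    have a2 : ∑ i, ∑ j, H i j * x j = ∑ i, g i * x i := by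
      rw [Finset.sum_comm, ← a1]
      exact Finset.sum_congr rfl fun i _ => Finset.sum_congr rfl fun j _ => by rw [hs]
    have a3 : ∑ i, ∑ j, H i j = ∑ i, g i := Finset.sum_congr rfl fun i _ => hg i
    have : ∀ i j, H i j * (x i - s) * (x j - s) = H i j * x i * x j - s * (H i j * x i)
      - s * (H i j * x j) + s ^ 2 * H i j := fun i j => by ring
    simp only [this, Finset.sum_add_distrib, Finset.sum_sub_distrib, ← Finset.mul_sum, a1, a2, a3]
    ring
  rw [e1, e2] at h1
  nlinarith [sq_nonneg (∑ i, g i * x i - s * ∑ i, g i)]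

lemma base_case {n : ℕ} (M : Matroid (Fin n)) (hE : M.E = Set.univ)
    (q : ℝ) (hq0 : 0 < q) (hq1 : q ≤ 1)
    (lam : Fin n → ℝ) (hlam : ∀ i, 0 < lam i)
    (k : ℕ) (hk : k ≤ n) (w : Finset (Fin n) → ℝ)
    (hwd : ∀ S, w S = q ^ (-(matRank n M S : ℤ)) * ∏ i ∈ S, lam i) (hw : ∀ S, 0 < w S)
    (T : Finset (Fin n)) (hT : T.card + 2 = k) (x : Fin n → ℝ) :
    (∑ i, ∑ j, HH k w T i j * x i * x j) * ∑ i, GG k w T i ≤ (∑ i, GG k w T i * x i) ^ 2 := by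
  have hkT : (k : ℝ) = T.card + 2 := by rw [← hT]; push_cast; ring
  set v : Fin n → ℝ := fun i => if i ∈ T then 0 else
    lam i * q ^ ((matRank n M T : ℤ) - (matRank n M (insert i T) : ℤ)) with hv
  have hwT := hw T
  refine rev_cs (HH k w T) (fun i => Real.sqrt (w T) * v i) (GG k w T) x (HH_symm w T) ?_ ?_ ?_
  · intro i; rw [sum_HH, hkT]; ring
  · rw [sum_GG, hkT]
    have := FF_pos hk w hw T (by omega)
    ring_nf; positivity
  · intro x
    have h := base_form M hE T q hq0 hq1 (fun i => v i * x i)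
    have h2 := mul_le_mul_of_nonneg_left h hwT.le
    have e : (∑ i, Real.sqrt (w T) * v i * x i) ^ 2 = w T * (∑ i, v i * x i) ^ 2 := by
      simp only [mul_assoc, ← Finset.mul_sum]
      rw [mul_pow, Real.sq_sqrt hwT.le]
    rw [e]
    refine le_trans (le_of_eq ?_) h2
    rw [Finset.mul_sum]
    refine Finset.sum_congr rfl fun i _ => ?_
    rw [Finset.mul_sum]
    refine Finset.sum_congr rfl fun j _ => ?_
    have key : HH k w T i j = w T * ((if i = j then 0 else
      q ^ (if M.closure (insert i (T : Set (Fin n))) = M.closure (insert j (T : Set (Fin n))) ∧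
        i ∉ M.closure (T : Set (Fin n)) then 1 else 0)) * v i * v j) := by
      unfold HH GG
      by_cases hj : j ∈ T
      · simp [hj, hv]
      by_cases hi : i ∈ T
      · simp [hi, hv]
      by_cases hij : i = j
      · simp [hij]
      have hr := rank_cross M hE T i j
      rw [if_neg hj, if_neg (by simp [hi, hij]), FF_top]
      · simp only [hv, hi, hj, hij, if_false]
        rw [hwd, hwd, Finset.prod_insert (by simp [hi, hij]), Finset.prod_insert hj]
        generalize (if M.closure (insert i (T : Set (Fin n))) = M.closure (insert j (T : Set (Fin n))) ∧
          i ∉ M.closure (T : Set (Fin n)) then 1 else 0) = δ at hr ⊢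
        have hz : -(matRank n M (insert i (insert j T)) : ℤ) = -(matRank n M T : ℤ) + (δ : ℤ)
          + ((matRank n M T : ℤ) - (matRank n M (insert i T) : ℤ))
          + ((matRank n M T : ℤ) - (matRank n M (insert j T) : ℤ)) := by omega
        rw [hz, zpow_add₀ hq0.ne', zpow_add₀ hq0.ne', zpow_add₀ hq0.ne', zpow_natCast]
        ring
      · rw [Finset.card_insert_of_notMem (by simp [hi, hij]), Finset.card_insert_of_notMem hj]
        omega
    rw [key]; ring

lemma pderiv_prodX {n : ℕ} (i : Fin n) (A : Finset (Fin n)) :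
    pderiv i (∏ j ∈ A, (X j : MP n)) = if i ∈ A then ∏ j ∈ A.erase i, X j else 0 := by
  induction A using Finset.induction_on with
  | empty => simp
  | insert a A ha ih =>
    rw [Finset.prod_insert ha, Derivation.leibniz, ih, pderiv_X]
    by_cases hia : i = a
    · subst hia
      simp [ha]
    · by_cases hi : i ∈ A
      · simp only [hi, if_true, Finset.mem_insert, or_true, smul_eq_mul]
        rw [Finset.erase_insert_of_ne (Ne.symm hia), Finset.prod_insert (by simp [ha])]
        simp [Pi.single_apply, hia, Ne.symm hia]
      · simp [hi, hia, Pi.single_apply, Ne.symm hia]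

lemma derivList_mono {n : ℕ} (l : List (Fin n)) (c : ℝ) (S : Finset (Fin n)) :
    derivList l (C c * ∏ j ∈ S, (X j : MP n)) =
      if l.Nodup ∧ l.toFinset ⊆ S then C c * ∏ j ∈ S \ l.toFinset, X j else 0 := by
  induction l with
  | nil => simp [derivList]
  | cons i l ih =>
    have : derivList (i :: l) (C c * ∏ j ∈ S, (X j : MP n))
      = pderiv i (derivList l (C c * ∏ j ∈ S, (X j : MP n))) := rfl
    rw [this, ih]
    by_cases h : l.Nodup ∧ l.toFinset ⊆ S
    · rw [if_pos h, pderiv_C_mul, pderiv_prodX]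
      by_cases hi : i ∈ S \ l.toFinset
      · rw [if_pos hi, if_pos]
        · congr 1
          · apply Finset.prod_congr _ (fun _ _ => rfl)
            ext x; simp; tauto
        · simp only [Finset.mem_sdiff, List.mem_toFinset] at hi
          refine ⟨List.nodup_cons.mpr ⟨hi.2, h.1⟩, ?_⟩
          rw [List.toFinset_cons]
          exact Finset.insert_subset hi.1 h.2
      · rw [if_neg hi, if_neg, mul_zero]
        rintro ⟨h1, h2⟩
        apply hi
        rw [List.toFinset_cons, Finset.insert_subset_iff] at h2
        simp only [Finset.mem_sdiff, List.mem_toFinset]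
        exact ⟨h2.1, (List.nodup_cons.mp h1).1⟩
    · rw [if_neg h, if_neg, map_zero]
      rintro ⟨h1, h2⟩
      rw [List.toFinset_cons, Finset.insert_subset_iff] at h2
      exact h ⟨(List.nodup_cons.mp h1).2, h2.2⟩

lemma derivList_sum {n : ℕ} {ι : Type} (l : List (Fin n)) (s : Finset ι) (f : ι → MP n) :
    derivList l (∑ a ∈ s, f a) = ∑ a ∈ s, derivList l (f a) := by
  induction l with
  | nil => rfl
  | cons i l ih =>
    change pderiv i (derivList l _) = ∑ a ∈ s, pderiv i (derivList l (f a))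
    rw [ih, map_sum]

lemma eval_derivList {n k : ℕ} (l : List (Fin n)) (w : Finset (Fin n) → ℝ) :
    eval (fun _ => (1:ℝ)) (derivList l
      (∑ S ∈ Finset.univ.filter (fun S : Finset (Fin n) => S.card = k),
        C (w S) * ∏ i ∈ S, (X i : MP n))) = if l.Nodup then FF k w l.toFinset else 0 := by
  rw [derivList_sum, map_sum]
  simp only [derivList_mono]
  unfold FF
  split_ifs with h
  · refine Finset.sum_congr rfl fun S _ => ?_
    by_cases h2 : l.toFinset ⊆ S <;> simp [h, h2]
  · simp [h]

lemma final_ineq {n k : ℕ} (hk : k ≤ n) (w : Finset (Fin n) → ℝ) (hw : ∀ S, 0 < w S)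
    (hbase : ∀ T : Finset (Fin n), T.card + 2 = k → ∀ x : Fin n → ℝ,
      (∑ i, ∑ j, HH k w T i j * x i * x j) * ∑ i, GG k w T i ≤ (∑ i, GG k w T i * x i) ^ 2)
    (T : Finset (Fin n)) (x : Fin n → ℝ) :
    FF k w T * (∑ i, ∑ j, HH k w T i j * x i * x j) ≤ (∑ i, GG k w T i * x i) ^ 2 := by
  by_cases hT : T.card + 2 ≤ k
  · obtain ⟨m, hm⟩ := Nat.exists_eq_add_of_le hT
    have h := lorentz hk w hw hbase m T hm.symm x
    have hkT : (k : ℝ) - T.card = m + 2 := by rw [hm]; push_cast; ring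
    rw [sum_GG, hkT] at h
    set Q := ∑ i, ∑ j, HH k w T i j * x i * x j
    set g := ∑ i, GG k w T i * x i
    have hF := FF_pos hk w hw T (by omega)
    set F := FF k w T
    have hm0 : (0:ℝ) ≤ m := Nat.cast_nonneg m
    by_cases hQ : Q ≤ 0
    · nlinarith [sq_nonneg g, mul_nonneg hF.le (neg_nonneg.mpr hQ)]
    · push Not at hQ
      have hFQ : 0 < F * Q := mul_pos hF hQ
      have h2 : (m + 1 : ℝ) * ((m + 2) * (F * Q)) ≤ (m + 1) * ((m + 1) * g ^ 2) := by
        nlinarith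
      have h3 := le_of_mul_le_mul_left h2 (by positivity)
      have h4 : (m + 1 : ℝ) * (F * Q) ≤ (m + 1) * g ^ 2 := by nlinarith
      exact le_of_mul_le_mul_left h4 (by positivity)
  · have : ∀ i j, HH k w T i j = 0 := by
      intro i j
      unfold HH GG
      split_ifs with h1 h2
      · rfl
      · rfl
      · apply FF_zero
        rw [Finset.card_insert_of_notMem h2, Finset.card_insert_of_notMem h1]
        omega
    simp only [this]
    simp
    positivity

theorem stmt10 (n : ℕ) (M : Matroid (Fin n)) (hE : M.E = Set.univ)
    (q : ℝ) (hq0 : 0 < q) (hq1 : q ≤ 1)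
    (lam : Fin n → ℝ) (hlam : ∀ i, 0 < lam i)
    (k : ℕ) (hk : k ≤ n) :
    StronglyLogConcaveAtOne
      (∑ S ∈ Finset.univ.filter (fun S : Finset (Fin n) => S.card = k),
        C (q ^ (-(matRank n M S : ℤ)) * ∏ i ∈ S, lam i) * ∏ i ∈ S, X i) := by
  intro l
  obtain ⟨w, hwd⟩ : ∃ w : Finset (Fin n) → ℝ,
    ∀ S, w S = q ^ (-(matRank n M S : ℤ)) * ∏ i ∈ S, lam i := ⟨_, fun _ => rfl⟩
  have hw : ∀ S, 0 < w S := fun S => by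
    rw [hwd]; exact mul_pos (zpow_pos hq0 _) (Finset.prod_pos fun i _ => hlam i)
  simp only [← hwd]
  have hfin := final_ineq hk w hw
    (fun T hT x => base_case M hE q hq0 hq1 lam hlam k hk w hwd hw T hT x)
  have he := fun l => eval_derivList (k := k) l w
  set f : MP n := ∑ S ∈ Finset.univ.filter (fun S : Finset (Fin n) => S.card = k),
        C (w S) * ∏ i ∈ S, (X i : MP n)
  have hg : ∀ i, gradOne (derivList l f) i = if l.Nodup then GG k w l.toFinset i else 0 := by
    intro i
    have := he (i :: l)
    change gradOne (derivList l f) i = _ at this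
    rw [this]
    simp only [List.nodup_cons, GG, List.toFinset_cons, List.mem_toFinset]
    by_cases h : l.Nodup <;> by_cases h2 : i ∈ l <;> simp [h, h2]
  have hh : ∀ i j, hessOne (derivList l f) i j = if l.Nodup then HH k w l.toFinset i j else 0 := by
    intro i j
    have := he (i :: j :: l)
    change hessOne (derivList l f) i j = _ at this
    rw [this]
    simp only [List.nodup_cons, HH, GG, List.toFinset_cons, List.mem_toFinset, List.mem_cons,
      Finset.mem_insert]
    by_cases h : l.Nodup <;> by_cases h2 : j ∈ l <;> by_cases h3 : i = j <;>
      by_cases h4 : i ∈ l <;> simp [h, h2, h3, h4]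
  unfold LogConcaveAtOne
  refine .of_dotProduct_mulVec_nonneg ?_ (fun x => ?_)
  · ext i j
    simp [Matrix.vecMulVec_apply, hh, HH_symm w _ i j, mul_comm]
  · have e : star x ⬝ᵥ ((vecMulVec (gradOne (derivList l f)) (gradOne (derivList l f))
        - eval (fun _ => (1:ℝ)) (derivList l f) • hessOne (derivList l f)) *ᵥ x)
      = (∑ i, gradOne (derivList l f) i * x i) ^ 2 - eval (fun _ => (1:ℝ)) (derivList l f) *
        ∑ i, ∑ j, hessOne (derivList l f) i j * x i * x j := by
      simp only [dotProduct, Matrix.mulVec, star_trivial]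
      rw [sq, Finset.sum_mul_sum, Finset.mul_sum, ← Finset.sum_sub_distrib]
      refine Finset.sum_congr rfl fun i _ => ?_
      rw [Finset.mul_sum, Finset.mul_sum, ← Finset.sum_sub_distrib]
      refine Finset.sum_congr rfl fun j _ => ?_
      simp only [Matrix.sub_apply, Matrix.smul_apply, Matrix.vecMulVec_apply, smul_eq_mul]
      ring
    rw [e, he l]
    simp only [hg, hh]
    by_cases h : l.Nodup
    · simp only [h, if_true]
      exact sub_nonneg.mpr (hfin _ x)
    · simp [h]

end
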